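/- Let i ≥ −1, n ≥ 1, 0 ≤ t ≤ n−1, and let U be a t-element subset of [n+i]. Then the number of C ∈ C_i(n) such that {j : C has a j⁺-full-set} = U equals #N_i(n−t), and the number of C ∈ C_i(n) such that U ⊆ {j : C has a j⁺-full-set} equals #C_i(n−t). -/

import Mathlib

/-!
Common definitions for formalizing "A recursion on maximal chains in the Tamari lattices"
(L. Nelson).

* Young diagrams are encoded by their row-length functions `lam : ℕ → ℕ` (rows indexed from 1,
  with `lam 0 = 0`).
* Dyck paths are lists of steps (north/east).
* Tableaux are encoded by entry functions `f : ℕ × ℕ → ℕ` (1-indexed boxes; value `0` means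
  "no box").  The label of box `(x, y)` is `f (x, y)`.
-/

noncomputable section

namespace TamariMaxChains

/-- A step of a lattice path: north or east. -/
inductive Step : Type
  | N : Step
  | E : Step
deriving DecidableEq

/-- Number of north steps of a path. -/
def nCount (p : List Step) : ℕ := p.count Step.N

/-- Number of east steps of a path. -/
def eCount (p : List Step) : ℕ := p.count Step.E

/-- `p` is a Dyck path: equally many norths and easts, and every prefix has at least as many
north steps as east steps (the path never goes below the diagonal `y = x`). -/
def IsDyck (p : List Step) : Prop :=
  nCount p = eCount p ∧ ∀ q : List Step, q <+: p → eCount q ≤ nCount q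

/-- `q` is a prime Dyck path: it meets the slope-one line joining its endpoints only at its
endpoints. -/
def IsPrimeDyck (q : List Step) : Prop :=
  q ≠ [] ∧ nCount q = eCount q ∧
    ∀ s : List Step, s <+: q → s ≠ [] → s ≠ q → eCount s < nCount s

/-- Covering relation of the Tamari lattice on Dyck paths:  `TamariCoverD P' P` means `P'`
covers `P`, i.e. `P'` is obtained from `P` by swapping an east step that is followed by a north
step with the prime Dyck subpath following it. -/
def TamariCoverD (P' P : List Step) : Prop :=
  ∃ a q b : List Step, IsPrimeDyck q ∧
    P = a ++ Step.E :: (q ++ b) ∧ P' = a ++ (q ++ Step.E :: b)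

/-- `lam` is the row-length function of a Young diagram: rows are indexed from `1`,
`lam x` is the number of boxes in row `x`, rows weakly decrease, finitely many boxes. -/
def IsDiagram (lam : ℕ → ℕ) : Prop :=
  lam 0 = 0 ∧ (∀ x, 1 ≤ x → lam (x + 1) ≤ lam x) ∧ ∃ N, ∀ x, N ≤ x → lam x = 0

/-- The height (number of north steps) of the prime path of row `d ≥ 1` of the Young diagram
with row lengths `lam`:  the least `t ≥ 1` such that either `t = d` (row `0` being regarded as
an infinite row of boxes) or row `d - t` has length at least `lam d + t`. -/
def primeHeight (lam : ℕ → ℕ) (d : ℕ) : ℕ :=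
  sInf {t | 1 ≤ t ∧ (t = d ∨ (t < d ∧ lam d + t ≤ lam (d - t)))}

/-- The last box of row `d` is a corner box (last box of its row and lowest box of
its column). -/
def IsCorner (lam : ℕ → ℕ) (d : ℕ) : Prop := 1 ≤ d ∧ 1 ≤ lam d ∧ lam (d + 1) < lam d

/-- The result of removing the `B`-strip of the last box `B` of row `d`: the last box of each of
the rows `d - h + 1, …, d` is removed, where `h` is the height of the prime path of row `d`. -/
def removeStrip (lam : ℕ → ℕ) (d : ℕ) : ℕ → ℕ := fun x =>
  if d + 1 ≤ x + primeHeight lam d ∧ x ≤ d then lam x - 1 else lam x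

/-- Covering relation of the Tamari lattice on Young diagrams:  `mu` covers `lam` iff `mu` is
obtained from `lam` by removing the `B`-strip of a corner box `B`. -/
def TamariCoverY (mu lam : ℕ → ℕ) : Prop := ∃ d, IsCorner lam d ∧ mu = removeStrip lam d

/-- The `B`-strip of the last box `B` of row `d`: the set of last boxes of rows
`d - h + 1, …, d`, where `h` is the height of the prime path of row `d`. -/
def stripSet (lam : ℕ → ℕ) (d : ℕ) : Set (ℕ × ℕ) :=
  {b | b.2 = lam b.1 ∧ 1 ≤ b.2 ∧ d + 1 ≤ b.1 + primeHeight lam d ∧ b.1 ≤ d}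

/-- The enclosure of the `B`-strip of the last box `B = (d, lam d)` of row `d`: all boxes
`(x, y)` with `d - h ≤ x ≤ d` and `lam d ≤ y ≤ lam d + h`, where row `0` is regarded as an
infinite row of boxes. -/
def enclosure (lam : ℕ → ℕ) (d : ℕ) : Set (ℕ × ℕ) :=
  {b | (b.1 = 0 ∨ b.2 ≤ lam b.1) ∧ 1 ≤ b.2 ∧
    d ≤ b.1 + primeHeight lam d ∧ b.1 ≤ d ∧ lam d ≤ b.2 ∧ b.2 ≤ lam d + primeHeight lam d}

/-- The Dyck path of length `2 n` corresponding to the Young diagram `lam` contained in the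
staircase `δ_{n-1}` (the Dyck path is the silhouette of the Young diagram). -/
def toDyck (n : ℕ) (lam : ℕ → ℕ) : List Step :=
  ((List.range n).flatMap fun k =>
    List.replicate (lam (n - k) - lam (n - k + 1)) Step.E ++ [Step.N]) ++
    List.replicate (n - lam 1) Step.E

/-- The prime path of row `d` of the Young diagram `lam`, as its list of steps (read from its
lower-left endpoint). -/
def primePathList (lam : ℕ → ℕ) (d : ℕ) : List Step :=
  Step.N :: ((((List.range (primeHeight lam d - 1)).flatMap fun j =>
    List.replicate (lam (d - 1 - j) - lam (d - j)) Step.E ++ [Step.N])) ++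
    List.replicate (lam d + primeHeight lam d - lam (d - (primeHeight lam d - 1))) Step.E)

/-- `S` translates to `S'` by `p` units down and `q` units to the right. -/
def TranslatesBy (p q : ℤ) (S S' : Set (ℕ × ℕ)) : Prop :=
  ∀ x y : ℕ, (x, y) ∈ S' ↔ ∃ a b : ℕ, (a, b) ∈ S ∧ (x : ℤ) = a + p ∧ (y : ℤ) = b + q

/-- `S` translates to `S'`. -/
def Translates (S S' : Set (ℕ × ℕ)) : Prop := ∃ p q : ℤ, TranslatesBy p q S S'

/-- The length of a tableau: its number of distinct labels (for an honest tableau, labels are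
exactly `1, …, tlen f`). -/
def tlen (f : ℕ × ℕ → ℕ) : ℕ := sSup {v | v ≠ 0 ∧ ∃ b, f b = v}

/-- The number of boxes in row `x` of a tableau. -/
def rowLen (f : ℕ × ℕ → ℕ) (x : ℕ) : ℕ := sSup {y | f (x, y) ≠ 0}

/-- The number of boxes in column `y` of a tableau. -/
def colLen (f : ℕ × ℕ → ℕ) (y : ℕ) : ℕ := sSup {x | f (x, y) ≠ 0}

/-- `f` is (the entry function of) a tableau: the support is a Young diagram (1-indexed),
rows strictly increase, columns weakly increase, and the set of labels is exactly
`{1, …, tlen f}`. -/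
def IsTableau (f : ℕ × ℕ → ℕ) : Prop :=
  (∀ y, f (0, y) = 0) ∧ (∀ x, f (x, 0) = 0) ∧
  {b : ℕ × ℕ | f b ≠ 0}.Finite ∧
  (∀ x y x' y', 1 ≤ x' → x' ≤ x → 1 ≤ y' → y' ≤ y → f (x, y) ≠ 0 → f (x', y') ≠ 0) ∧
  (∀ x y, f (x, y) ≠ 0 → f (x, y + 1) ≠ 0 → f (x, y) < f (x, y + 1)) ∧
  (∀ x y, f (x, y) ≠ 0 → f (x + 1, y) ≠ 0 → f (x, y) ≤ f (x + 1, y)) ∧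
  (∀ v, 1 ≤ v → (v ≤ tlen f ↔ ∃ b, f b = v))

/-- `T^(r)`: the subtableau of all entries at most `r`. -/
def trunc (f : ℕ × ℕ → ℕ) (r : ℕ) : ℕ × ℕ → ℕ := fun b => if f b ≤ r then f b else 0

/-- The shape (row-length function) of a tableau. -/
def shapeOf (f : ℕ × ℕ → ℕ) : ℕ → ℕ := fun x => rowLen f x

/-- The row index of the end-box of the `k`-set of `f` (the maximal row index of a box
labeled `k`). -/
def endRow (f : ℕ × ℕ → ℕ) (k : ℕ) : ℕ := sSup {x | ∃ y, f (x, y) = k}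

/-- `Y 0 ⋗ Y 1 ⋗ ⋯ ⋗ Y l` is a saturated chain in the Tamari order on Young diagrams whose
maximal element `Y 0` is the empty diagram (each `Y r` covers `Y (r+1)`). -/
def IsTamariChain (Y : ℕ → ℕ → ℕ) (l : ℕ) : Prop :=
  (∀ r, r ≤ l → IsDiagram (Y r)) ∧ (∀ x, Y 0 x = 0) ∧
    ∀ r, r < l → TamariCoverY (Y r) (Y (r + 1))

/-- The tableau `ψ(C)` of the saturated chain `C = (∅ = Y 0 ⋗ ⋯ ⋗ Y l)`: the boxes removed in
the transition `Y (r-1) ⋗ Y r` are labeled `r`; that is, each box of `Y l` is labeled by the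
least `r` such that the box belongs to `Y r`. -/
def psiFun (Y : ℕ → ℕ → ℕ) (l : ℕ) : ℕ × ℕ → ℕ := fun b =>
  if 1 ≤ b.1 ∧ 1 ≤ b.2 ∧ b.2 ≤ Y l b.1 then sInf {r | r ≤ l ∧ b.2 ≤ Y r b.1} else 0

/-- `f` is a `ψ`-tableau: it is in the image of `ψ`. -/
def IsPsiTab (f : ℕ × ℕ → ℕ) : Prop :=
  ∃ l Y, IsTamariChain Y l ∧ f = psiFun Y l

/-- Row lengths of the staircase shape `δ_{n-1} = (n-1, n-2, …, 1)`: row `x ≥ 1` has `n - x`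
boxes. -/
def dstair (n : ℕ) : ℕ → ℕ := fun x => if x = 0 then 0 else n - x

/-- `C_i(n)`, via `ψ`: the set of maximal chains of length `n + i` in the Tamari lattice `T_n`,
identified with the `ψ`-tableaux of length `n + i` and shape `δ_{n-1}`. -/
def MemC (i : ℤ) (n : ℕ) (f : ℕ × ℕ → ℕ) : Prop :=
  IsTableau f ∧ IsPsiTab f ∧ (∀ x, rowLen f x = dstair n x) ∧ (tlen f : ℤ) = (n : ℤ) + i

/-- The `r`-set of `f` (of shape `δ_{n-1}`) is a full-set with end-box `(k, n - k)`:
it begins in row `1` and ends in the outer diagonal, at the box `(k, n - k)`. -/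
def HasFullSetAt (f : ℕ × ℕ → ℕ) (n r k : ℕ) : Prop :=
  (∃ y, f (1, y) = r) ∧ 1 ≤ k ∧ k ≤ n - 1 ∧ f (k, n - k) = r ∧
    ∀ x y, f (x, y) = r → x ≤ k

/-- `f` has an `r`-full-set. -/
def HasFullSet (f : ℕ × ℕ → ℕ) (n r : ℕ) : Prop := ∃ k, HasFullSetAt f n r k

/-- `f` has an `r⁺`-full-set (plus-full-set): an `r`-full-set whose end-box `(k, n-k)` satisfies
`k = n - 1`, or `k ≤ n - 2` and the southwest neighbor has a smaller label. -/
def HasPlusFullSet (f : ℕ × ℕ → ℕ) (n r : ℕ) : Prop :=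
  ∃ k, HasFullSetAt f n r k ∧ (k = n - 1 ∨ (k ≤ n - 2 ∧ f (k + 1, n - k - 1) < r))

/-- `F_i^r(n)`: the set of `C ∈ C_i(n)` whose `r`-set is a plus-full-set and whose `j`-set is
not a plus-full-set for any `j ∈ [r-1]`. -/
def MemF (i : ℤ) (n : ℕ) (r : ℕ) (f : ℕ × ℕ → ℕ) : Prop :=
  MemC i n f ∧ HasPlusFullSet f n r ∧ ∀ j, 1 ≤ j → j < r → ¬ HasPlusFullSet f n j

/-- `N_i(n)`: the set of `C ∈ C_i(n)` having no plus-full-sets. -/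
def MemN (i : ℤ) (n : ℕ) (f : ℕ × ℕ → ℕ) : Prop :=
  MemC i n f ∧ ∀ r, ¬ HasPlusFullSet f n r

/-- `α_d`: shift all rows of index greater than `d` down one row and repeat row `d` in
row `d + 1`. -/
def alphaFun (d : ℕ) (f : ℕ × ℕ → ℕ) : ℕ × ℕ → ℕ := fun b =>
  if b.1 ≤ d then f b else f (b.1 - 1, b.2)

/-- `β_d`: append a box labeled `tlen f + 1` at the end of each of the rows `1, …, d`. -/
def betaFun (d : ℕ) (f : ℕ × ℕ → ℕ) : ℕ × ℕ → ℕ := fun b =>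
  if 1 ≤ b.1 ∧ b.1 ≤ d ∧ b.2 = rowLen f b.1 + 1 then tlen f + 1 else f b

/-- The number of boxes of row `x` of `f` whose label is at most `r` (these occupy an initial
segment of the row). -/
def lowLen (f : ℕ × ℕ → ℕ) (r x : ℕ) : ℕ := sSup {y | f (x, y) ≠ 0 ∧ f (x, y) ≤ r}

/-- The row index `d` used in the definition of `Ĉ(r)`: the minimal `k ∈ [n-1]` with
`C (k, n-k) ≤ r` if such `k` exists, and `n` otherwise. -/
def hatD (f : ℕ × ℕ → ℕ) (n r : ℕ) : ℕ :=
  sInf ({k | 1 ≤ k ∧ k ≤ n - 1 ∧ 1 ≤ f (k, n - k) ∧ f (k, n - k) ≤ r} ∪ {n})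

/-- `Ĉ(r)` for `C ∈ C_i(n)` and `0 ≤ r ≤ n + i`: starting from `β_d(α_d(C^(r)))` (where `d` is
as in `hatD`), the entries of `C` greater than `r` of row index less than `d` are translated one
unit to the right, those of row index greater than `d` are translated one unit down, and all
these labels are incremented by one. -/
def hatFun (f : ℕ × ℕ → ℕ) (n r : ℕ) : ℕ × ℕ → ℕ := fun b =>
  let d := hatD f n r
  let x := b.1
  let y := b.2
  if x = 0 ∨ y = 0 then 0
  else if x ≤ d then
    if f (x, y) ≠ 0 ∧ f (x, y) ≤ r then f (x, y)
    else if y = lowLen f r x + 1 then r + 1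
    else if r < f (x, y - 1) then f (x, y - 1) + 1
    else 0
  else if x = d + 1 then f (d, y)
  else if f (x - 1, y) = 0 then 0
  else if f (x - 1, y) ≤ r then f (x - 1, y)
  else f (x - 1, y) + 1

/-- `RepBy i m t r C0 C` : `C = (φ_{i,m+t-1}^{r 1} ∘ φ_{i,m+t-2}^{r 2} ∘ ⋯ ∘ φ_{i,m}^{r t}) C0`,
each factor being applied within its domain. -/
def RepBy (i : ℤ) (m t : ℕ) (r : ℕ → ℕ) (C0 C : ℕ × ℕ → ℕ) : Prop :=
  ∃ D : ℕ → ℕ × ℕ → ℕ, D 0 = C0 ∧ D t = C ∧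
    ∀ s, s < t →
      MemC i (m + s) (D s) ∧
      ((r (t - s) : ℤ) ≤ (m : ℤ) + s + i) ∧
      (∀ j, 1 ≤ j → j ≤ r (t - s) → ¬ HasPlusFullSet (D s) (m + s) j) ∧
      D (s + 1) = hatFun (D s) (m + s) (r (t - s))

/-- The set `𝕏_{d,n-1}^r` of Theorem 4.3: `ψ`-tableaux of length `r`, contained in `δ_{n-1}`,
whose row `d` has length `n - d` and whose prime path of row `d` has height `d`. -/
def MemX (d n r : ℕ) (f : ℕ × ℕ → ℕ) : Prop :=
  IsTableau f ∧ IsPsiTab f ∧ tlen f = r ∧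
    (∀ x, 1 ≤ x → rowLen f x ≤ n - x) ∧
    rowLen f d = n - d ∧
    primeHeight (shapeOf f) d = d

/-- The set `ℤ_{d,n}^{r+1}` of Theorem 4.3: `ψ`-tableaux of length `r + 1`, contained in `δ_n`,
such that rows `d` and `d+1` of the truncation at `r` are identical, the end-box of the
`(r+1)`-set is `(d, n-d+1)`, and the prime path of `(d, n-d+1)` has height `d`. -/
def MemZ (d n r : ℕ) (g : ℕ × ℕ → ℕ) : Prop :=
  IsTableau g ∧ IsPsiTab g ∧ tlen g = r + 1 ∧
    (∀ x, 1 ≤ x → rowLen g x ≤ n + 1 - x) ∧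
    (∀ y, trunc g r (d, y) = trunc g r (d + 1, y)) ∧
    g (d, n - d + 1) = r + 1 ∧ (∀ x y, g (x, y) = r + 1 → x ≤ d) ∧
    primeHeight (shapeOf g) d = d

/-! ### Chains, pointwise -/

/-- One step of a chain, described by its end row `e` and the row `b < e` which blocks it. -/
def Stp (lam mu : ℕ → ℕ) (e b : ℕ) : Prop :=
  b < e ∧ lam (e + 1) < lam e ∧ (∀ x, b < x → x < e → lam x + x < lam e + e) ∧
  (b = 0 ∨ lam e + e ≤ lam b + b) ∧ (∀ x, b < x → x ≤ e → mu x + 1 = lam x) ∧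
  (∀ x, ¬ (b < x ∧ x ≤ e) → mu x = lam x)

/-- Maximal chains of length `l` of the Tamari lattice of order `n`, as functions that are
constant from `l` on. -/
structure Ch (n l : ℕ) (Y : ℕ → ℕ → ℕ) : Prop where
  zero : ∀ s, Y s 0 = 0
  anti : ∀ s x, 1 ≤ x → Y s (x + 1) ≤ Y s x
  init : ∀ x, Y 0 x = 0
  step : ∀ s, s < l → ∃ e b, Stp (Y (s + 1)) (Y s) e b
  fin : ∀ s, l ≤ s → ∀ x, 1 ≤ x → Y s x = n - x

/-- The `(r+1)`-set is a plus-full-set with end row `k`. -/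
def Q (Y : ℕ → ℕ → ℕ) (n r k : ℕ) : Prop :=
  Stp (Y (r + 1)) (Y r) k 0 ∧ Y (r + 1) k + k = n ∧ Y r (k + 1) + (k + 1) = n

/-- Chain version of `HasPlusFullSet`. -/
def PF (Y : ℕ → ℕ → ℕ) (n j : ℕ) : Prop := ∃ r k, j = r + 1 ∧ Q Y n r k

/-- Row `d` is doubled. -/
def Lo (d : ℕ) (lam Lam : ℕ → ℕ) : Prop :=
  (∀ x, x ≤ d → Lam x = lam x) ∧ (∀ x, d ≤ x → Lam (x + 1) = lam x)

/-- Row `d` is doubled, then a box is appended to rows `1, …, d`. -/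
def Hi (d : ℕ) (lam Lam : ℕ → ℕ) : Prop :=
  Lam 0 = lam 0 ∧ (∀ x, 1 ≤ x → x ≤ d → Lam x = lam x + 1) ∧ (∀ x, d ≤ x → Lam (x + 1) = lam x)

/-- The prime path of row `d` reaches row `0`. -/
def Top (d : ℕ) (lam : ℕ → ℕ) : Prop := ∀ x, 1 ≤ x → x < d → lam x + x < lam d + d

/-- `Z` is obtained from `Y` by inserting a plus-full-set with label `r+1`, end row `d`. -/
def Rel (r d : ℕ) (Y Z : ℕ → ℕ → ℕ) : Prop :=
  (∀ s, s ≤ r → Lo d (Y s) (Z s)) ∧ (∀ s, r ≤ s → Hi d (Y s) (Z (s + 1)))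

theorem Stp.le {lam mu e b} (h : Stp lam mu e b) (x : ℕ) : mu x ≤ lam x := by
  obtain ⟨_, _, _, _, h5, h6⟩ := h
  by_cases hx : b < x ∧ x ≤ e
  · have := h5 x hx.1 hx.2; omega
  · exact (h6 x hx).le

theorem Stp.mem {lam mu e b} (h : Stp lam mu e b) {x : ℕ} (hx : mu x ≠ lam x) :
    b < x ∧ x ≤ e := by
  by_contra hc; exact hx (h.2.2.2.2.2 x hc)

theorem Stp.ne {lam mu e b} (h : Stp lam mu e b) {x : ℕ} (h1 : b < x) (h2 : x ≤ e) :
    mu x ≠ lam x := by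
  have := h.2.2.2.2.1 x h1 h2; omega

theorem Stp.unique {lam mu e b e' b'} (h : Stp lam mu e b) (h' : Stp lam mu e' b') : e = e' := by
  have h1 := h'.mem (h.ne h.1 le_rfl)
  have h2 := h.mem (h'.ne h'.1 le_rfl)
  omega

theorem Stp.inv {lam mu e b d} (h : Stp lam mu e b) (hd : 1 ≤ d) (H : Top d lam) :
    Top d mu ∧ (b < d → d ≤ e → b = 0) := by
  have key : b < d → d ≤ e → b = 0 := by
    intro h1 h2
    obtain ⟨_, _, h3, h4, _, _⟩ := h
    rcases h4 with h4 | h4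
    · exact h4
    · by_contra hb
      have := H b (by omega) h1
      rcases h2.lt_or_eq with h2 | rfl
      · have := h3 d h1 h2; omega
      · omega
  refine ⟨?_, key⟩
  intro x hx hxd
  have := H x hx hxd
  by_cases hm : b < d ∧ d ≤ e
  · have hb := key hm.1 hm.2
    have h5 := h.2.2.2.2.1 x (by omega) (by omega)
    have h6 := h.2.2.2.2.1 d (by omega) (by omega)
    omega
  · have h6 := h.2.2.2.2.2 d hm
    have := h.le x
    omega

theorem Stp.dup {lam mu e b d} (h : Stp lam mu e b) (hd : 1 ≤ d) (H : Top d lam)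
    (he : lam (d + 1) = lam d) : mu (d + 1) = mu d := by
  have H' : Top (d + 1) lam := by
    intro x hx hxd
    rcases Nat.lt_succ_iff_lt_or_eq.1 hxd with h1 | rfl
    · have := H x hx h1; omega
    · omega
  have k := (h.inv (by omega) H').2
  obtain ⟨_, h2, _, _, h5, h6⟩ := h
  have hne : e ≠ d := by rintro rfl; omega
  by_cases hm : b < d + 1 ∧ d + 1 ≤ e
  · have := k hm.1 hm.2
    have a1 := h5 d (by omega) (by omega)
    have a2 := h5 (d + 1) (by omega) (by omega)
    omega
  · have a1 := h6 d (by omega)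
    have a2 := h6 (d + 1) hm
    omega

theorem lo_up {lam mu Lam Mu e b d} (hd : 1 ≤ d) (hl : Lo d lam Lam) (hm : Lo d mu Mu)
    (H : Top d lam) (h : Stp lam mu e b) :
    (e < d ∧ Stp Lam Mu e b) ∨ (d ≤ e ∧ b = 0 ∧ Stp Lam Mu (e + 1) 0) ∨
      (d ≤ b ∧ Stp Lam Mu (e + 1) (b + 1)) := by
  have key := (h.inv hd H).2
  obtain ⟨h1, h2, h3, h4, h5, h6⟩ := h
  obtain ⟨l1, l2⟩ := hl
  obtain ⟨m1, m2⟩ := hm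
  by_cases he : e < d
  · left
    refine ⟨he, h1, ?_, ?_, ?_, ?_, ?_⟩
    · rw [l1 _ (by omega), l1 _ (by omega)]; exact h2
    · intro x a1 a2
      rw [l1 _ (by omega), l1 _ (by omega)]; exact h3 x a1 a2
    · rw [l1 _ (by omega), l1 _ (by omega)]; exact h4
    · intro x a1 a2
      rw [l1 _ (by omega), m1 _ (by omega)]; exact h5 x a1 a2
    · intro x hx
      by_cases hxd : x ≤ d
      · rw [l1 _ hxd, m1 _ hxd]; exact h6 x hx
      · obtain ⟨y, rfl⟩ : ∃ y, x = y + 1 := ⟨x - 1, by omega⟩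
        rw [l2 _ (by omega), m2 _ (by omega)]; exact h6 y (by omega)
  right
  by_cases hb : b < d
  · left
    have hb0 := key hb (by omega)
    subst hb0
    refine ⟨by omega, rfl, by omega, ?_, ?_, Or.inl rfl, ?_, ?_⟩
    · rw [l2 _ (by omega), l2 _ (by omega)]; exact h2
    · intro x a1 a2
      rw [l2 e (by omega)]
      have hde : d = e ∨ lam d + d < lam e + e := by
        rcases Nat.lt_or_ge d e with q | q
        · right; exact h3 d hb q
        · left; omega
      by_cases hxd : x < d
      · rw [l1 _ hxd.le]
        have := H x a1 hxd
        rcases hde with rfl | q <;> omega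
      · rcases Nat.lt_or_ge d x with q | q
        · obtain ⟨y, rfl⟩ : ∃ y, x = y + 1 := ⟨x - 1, by omega⟩
          rw [l2 _ (by omega)]
          have := h3 y (by omega) (by omega); omega
        · obtain rfl : x = d := by omega
          rw [l1 _ le_rfl]
          rcases hde with q | q
          · rw [← q]; omega
          · omega
    · intro x a1 a2
      by_cases hxd : x ≤ d
      · rw [l1 _ hxd, m1 _ hxd]; exact h5 x a1 (by omega)
      · obtain ⟨y, rfl⟩ : ∃ y, x = y + 1 := ⟨x - 1, by omega⟩
        rw [l2 _ (by omega), m2 _ (by omega)]; exact h5 y (by omega) (by omega)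
    · intro x hx
      by_cases hxd : x ≤ d
      · rw [l1 _ hxd, m1 _ hxd]; exact h6 x (by omega)
      · obtain ⟨y, rfl⟩ : ∃ y, x = y + 1 := ⟨x - 1, by omega⟩
        rw [l2 _ (by omega), m2 _ (by omega)]; exact h6 y (by omega)
  · right
    refine ⟨by omega, by omega, ?_, ?_, ?_, ?_, ?_⟩
    · rw [l2 _ (by omega), l2 _ (by omega)]; exact h2
    · intro x a1 a2
      obtain ⟨y, rfl⟩ : ∃ y, x = y + 1 := ⟨x - 1, by omega⟩
      rw [l2 e (by omega), l2 y (by omega)]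
      have := h3 y (by omega) (by omega); omega
    · rw [l2 e (by omega), l2 b (by omega)]; omega
    · intro x a1 a2
      obtain ⟨y, rfl⟩ : ∃ y, x = y + 1 := ⟨x - 1, by omega⟩
      rw [l2 _ (by omega), m2 _ (by omega)]; exact h5 y (by omega) (by omega)
    · intro x hx
      by_cases hxd : x ≤ d
      · rw [l1 _ hxd, m1 _ hxd]; exact h6 x (by omega)
      · obtain ⟨y, rfl⟩ : ∃ y, x = y + 1 := ⟨x - 1, by omega⟩
        rw [l2 _ (by omega), m2 _ (by omega)]; exact h6 y (by omega)

theorem lo_down {lam mu Lam Mu e b d} (hd : 1 ≤ d) (hl : Lo d lam Lam) (hm : Lo d mu Mu)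
    (H : Top d lam) (h : Stp Lam Mu e b) :
    (e < d ∧ Stp lam mu e b) ∨ (∃ e0, e = e0 + 1 ∧ d ≤ e0 ∧ b = 0 ∧ Stp lam mu e0 0) ∨
      (∃ e0 b0, e = e0 + 1 ∧ b = b0 + 1 ∧ d ≤ b0 ∧ Stp lam mu e0 b0) := by
  obtain ⟨l1, l2⟩ := hl
  obtain ⟨m1, m2⟩ := hm
  have H1 : Top (d + 1) Lam := by
    intro x hx hxd
    rw [l2 d le_rfl, l1 x (by omega)]
    rcases Nat.lt_succ_iff_lt_or_eq.1 hxd with h1 | rfl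
    · have := H x hx h1; omega
    · omega
  have key := (h.inv (by omega) H1).2
  obtain ⟨h1, h2, h3, h4, h5, h6⟩ := h
  have hne : e ≠ d := by
    rintro rfl; rw [l2 _ le_rfl, l1 _ le_rfl] at h2; omega
  by_cases he : e < d
  · left
    refine ⟨he, h1, ?_, ?_, ?_, ?_, ?_⟩
    · rw [← l1 _ (by omega), ← l1 _ (by omega)]; exact h2
    · intro x a1 a2
      rw [← l1 _ (by omega), ← l1 _ (by omega)]; exact h3 x a1 a2
    · rw [← l1 _ (by omega), ← l1 _ (by omega)]; exact h4
    · intro x a1 a2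
      rw [← l1 _ (by omega), ← m1 _ (by omega)]; exact h5 x a1 a2
    · intro x hx
      by_cases hxd : x ≤ d
      · rw [← l1 _ hxd, ← m1 _ hxd]; exact h6 x hx
      · rw [← l2 _ (by omega), ← m2 _ (by omega)]; exact h6 (x + 1) (by omega)
  right
  obtain ⟨e, rfl⟩ : ∃ y, e = y + 1 := ⟨e - 1, by omega⟩
  by_cases hb : b < d + 1
  · left
    have hb0 := key hb (by omega)
    subst hb0
    refine ⟨e, rfl, by omega, rfl, by omega, ?_, ?_, Or.inl rfl, ?_, ?_⟩
    · rw [← l2 _ (by omega), ← l2 _ (by omega)]; exact h2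
    · intro x a1 a2
      by_cases hxd : x < d
      · have q := H x a1 hxd
        rcases Nat.lt_or_ge d e with q2 | q2
        · have := h3 (d + 1) (by omega) (by omega)
          rw [l2 _ le_rfl, l2 _ (by omega)] at this
          omega
        · obtain rfl : e = d := by omega
          omega
      · have := h3 (x + 1) (by omega) (by omega)
        rw [l2 _ (by omega), l2 _ (by omega)] at this
        omega
    · intro x a1 a2
      by_cases hxd : x ≤ d
      · rw [← l1 _ hxd, ← m1 _ hxd]; exact h5 x a1 (by omega)
      · rw [← l2 _ (by omega), ← m2 _ (by omega)]; exact h5 (x + 1) (by omega) (by omega)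
    · intro x hx
      by_cases hxd : x ≤ d
      · rw [← l1 _ hxd, ← m1 _ hxd]; exact h6 x (by omega)
      · rw [← l2 _ (by omega), ← m2 _ (by omega)]; exact h6 (x + 1) (by omega)
  · right
    obtain ⟨b, rfl⟩ : ∃ y, b = y + 1 := ⟨b - 1, by omega⟩
    refine ⟨e, b, rfl, rfl, by omega, by omega, ?_, ?_, ?_, ?_, ?_⟩
    · rw [← l2 _ (by omega), ← l2 _ (by omega)]; exact h2
    · intro x a1 a2
      have := h3 (x + 1) (by omega) (by omega)
      rw [l2 e (by omega), l2 x (by omega)] at this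
      omega
    · rw [l2 e (by omega), l2 b (by omega)] at h4; omega
    · intro x a1 a2
      rw [← l2 _ (by omega), ← m2 _ (by omega)]; exact h5 (x + 1) (by omega) (by omega)
    · intro x hx
      by_cases hxd : x ≤ d
      · rw [← l1 _ hxd, ← m1 _ hxd]; exact h6 x (by omega)
      · rw [← l2 _ (by omega), ← m2 _ (by omega)]; exact h6 (x + 1) (by omega)

theorem hi_up {lam mu Lam Mu e b d} (hd : 1 ≤ d) (hl : Hi d lam Lam) (hm : Hi d mu Mu)
    (H : mu d = lam d) (h : Stp lam mu e b) :
    (e < d ∧ Stp Lam Mu e b) ∨ (d ≤ b ∧ Stp Lam Mu (e + 1) (b + 1)) := by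
  have hdm : ¬ (b < d ∧ d ≤ e) := fun hc => h.ne hc.1 hc.2 H
  obtain ⟨h1, h2, h3, h4, h5, h6⟩ := h
  obtain ⟨l0, l1, l2⟩ := hl
  obtain ⟨m0, m1, m2⟩ := hm
  have hrest : ∀ x, d ≤ x → ¬ (b < x ∧ x ≤ e) → Mu (x + 1) = Lam (x + 1) := by
    intro x q hx
    rw [l2 x q, m2 x q]; exact h6 x hx
  have hrest2 : ∀ x, x ≤ d → ¬ (b < x ∧ x ≤ e) → Mu x = Lam x := by
    intro x q hx
    have := h6 x hx
    rcases Nat.eq_zero_or_pos x with rfl | q0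
    · omega
    · rw [l1 x q0 q, m1 x q0 q]; omega
  by_cases he : e < d
  · left
    refine ⟨he, h1, ?_, ?_, ?_, ?_, ?_⟩
    · rw [l1 _ (by omega) (by omega), l1 _ (by omega) (by omega)]; omega
    · intro x a1 a2
      have := h3 x a1 a2
      rw [l1 _ (by omega) (by omega), l1 _ (by omega) (by omega)]; omega
    · rcases h4 with h4 | h4
      · left; exact h4
      · rcases Nat.eq_zero_or_pos b with q | q
        · left; exact q
        · right
          rw [l1 _ (by omega) (by omega), l1 _ (by omega) (by omega)]; omega
    · intro x a1 a2
      have := h5 x a1 a2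
      rw [l1 _ (by omega) (by omega), m1 _ (by omega) (by omega)]; omega
    · intro x hx
      by_cases hxd : x ≤ d
      · exact hrest2 x hxd hx
      · obtain ⟨y, rfl⟩ : ∃ y, x = y + 1 := ⟨x - 1, by omega⟩
        exact hrest y (by omega) (by omega)
  · right
    refine ⟨by omega, by omega, ?_, ?_, ?_, ?_, ?_⟩
    · rw [l2 _ (by omega), l2 _ (by omega)]; exact h2
    · intro x a1 a2
      obtain ⟨y, rfl⟩ : ∃ y, x = y + 1 := ⟨x - 1, by omega⟩
      rw [l2 e (by omega), l2 y (by omega)]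
      have := h3 y (by omega) (by omega); omega
    · rw [l2 e (by omega), l2 b (by omega)]; omega
    · intro x a1 a2
      obtain ⟨y, rfl⟩ : ∃ y, x = y + 1 := ⟨x - 1, by omega⟩
      rw [l2 _ (by omega), m2 _ (by omega)]; exact h5 y (by omega) (by omega)
    · intro x hx
      by_cases hxd : x ≤ d
      · exact hrest2 x hxd (by omega)
      · obtain ⟨y, rfl⟩ : ∃ y, x = y + 1 := ⟨x - 1, by omega⟩
        exact hrest y (by omega) (by omega)

theorem hi_down {lam mu Lam Mu e b d} (hd : 1 ≤ d) (hl : Hi d lam Lam) (hm : Hi d mu Mu)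
    (H : mu d = lam d) (h : Stp Lam Mu e b) :
    (e < d ∧ Stp lam mu e b) ∨
      (∃ e0 b0, e = e0 + 1 ∧ b = b0 + 1 ∧ d ≤ b0 ∧ Stp lam mu e0 b0) := by
  obtain ⟨l0, l1, l2⟩ := hl
  obtain ⟨m0, m1, m2⟩ := hm
  have hdm : ¬ (b < d ∧ d ≤ e) := fun hc => h.ne hc.1 hc.2 (by
    rw [l1 d hd le_rfl, m1 d hd le_rfl, H])
  have hdm' : ¬ (b < d + 1 ∧ d + 1 ≤ e) := fun hc => h.ne hc.1 hc.2 (by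
    rw [l2 d le_rfl, m2 d le_rfl, H])
  obtain ⟨h1, h2, h3, h4, h5, h6⟩ := h
  have hrest : ∀ x, d ≤ x → ¬ (b < x + 1 ∧ x + 1 ≤ e) → mu x = lam x := by
    intro x q hx
    rw [← l2 x q, ← m2 x q]; exact h6 (x + 1) hx
  have hrest2 : ∀ x, x ≤ d → ¬ (b < x ∧ x ≤ e) → mu x = lam x := by
    intro x q hx
    have := h6 x hx
    rcases Nat.eq_zero_or_pos x with rfl | q0
    · omega
    · rw [l1 x q0 q, m1 x q0 q] at this; omega
  by_cases he : e < d
  · left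
    refine ⟨he, h1, ?_, ?_, ?_, ?_, ?_⟩
    · rw [l1 _ (by omega) (by omega), l1 _ (by omega) (by omega)] at h2; omega
    · intro x a1 a2
      have := h3 x a1 a2
      rw [l1 _ (by omega) (by omega), l1 _ (by omega) (by omega)] at this; omega
    · rcases Nat.eq_zero_or_pos b with q | q
      · left; exact q
      · right
        rw [l1 _ (by omega) (by omega), l1 _ (by omega) (by omega)] at h4; omega
    · intro x a1 a2
      have := h5 x a1 a2
      rw [l1 _ (by omega) (by omega), m1 _ (by omega) (by omega)] at this; omega
    · intro x hx
      by_cases hxd : x ≤ d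
      · exact hrest2 x hxd hx
      · exact hrest x (by omega) (by omega)
  · right
    obtain ⟨e, rfl⟩ : ∃ y, e = y + 1 := ⟨e - 1, by omega⟩
    obtain ⟨b, rfl⟩ : ∃ y, b = y + 1 := ⟨b - 1, by omega⟩
    refine ⟨e, b, rfl, rfl, by omega, by omega, ?_, ?_, ?_, ?_, ?_⟩
    · rw [← l2 _ (by omega), ← l2 _ (by omega)]; exact h2
    · intro x a1 a2
      have := h3 (x + 1) (by omega) (by omega)
      rw [l2 e (by omega), l2 x (by omega)] at this
      omega
    · rw [l2 e (by omega), l2 b (by omega)] at h4; omega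
    · intro x a1 a2
      rw [← l2 _ (by omega), ← m2 _ (by omega)]; exact h5 (x + 1) (by omega) (by omega)
    · intro x hx
      by_cases hxd : x ≤ d
      · exact hrest2 x hxd (by omega)
      · exact hrest x (by omega) (by omega)

theorem Ch.le_succ {n l Y} (h : Ch n l Y) (s x : ℕ) : Y s x ≤ Y (s + 1) x := by
  by_cases hs : s < l
  · obtain ⟨e, b, hst⟩ := h.step s hs
    exact hst.le x
  · rcases Nat.eq_zero_or_pos x with rfl | hx
    · rw [h.zero, h.zero]
    · rw [h.fin s (by omega) x hx, h.fin (s + 1) (by omega) x hx]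

theorem Ch.mono {n l Y} (h : Ch n l Y) {s s' : ℕ} (hs : s ≤ s') (x : ℕ) : Y s x ≤ Y s' x :=
  monotone_nat_of_le_succ (f := fun s => Y s x) (fun s => h.le_succ s x) hs

theorem Ch.bound {n l Y} (h : Ch n l Y) (s x : ℕ) (hx : 1 ≤ x) : Y s x ≤ n - x := by
  have h1 := h.mono (le_max_left s l) x
  rw [h.fin _ (le_max_right s l) x hx] at h1
  exact h1

/-- the key step, from small to large -/
theorem exists_up {n l Y} (hn : 1 ≤ n) (h : Ch n l Y) (r : ℕ) (hr : r ≤ l) :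
    ∃ d Z, 1 ≤ d ∧ Y r d + d = n ∧ Top d (Y r) ∧ Ch (n + 1) (l + 1) Z ∧ Rel r d Y Z ∧
      Q Z (n + 1) r d := by
  classical
  have hex : ∃ d, 1 ≤ d ∧ Y r d + d = n :=
    ⟨n, hn, by have := h.bound r n hn; omega⟩
  obtain ⟨hd1, hd2⟩ := Nat.find_spec hex
  have hmin := fun m (hm : m < Nat.find hex) => Nat.find_min hex hm
  generalize Nat.find hex = d at hd1 hd2 hmin
  have hdn : d ≤ n := by omega
  have htop : Top d (Y r) := by
    intro x hx hxd
    have h1 := h.bound r x hx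
    have h2 := hmin x hxd
    rw [hd2]
    by_contra hc
    exact h2 ⟨hx, by omega⟩
  have htops : ∀ s, s ≤ r → Top d (Y s) := by
    intro s hs
    induction hs using Nat.decreasingInduction with
    | self => exact htop
    | of_succ k hk ih =>
      obtain ⟨e, b, hst⟩ := h.step k (by omega)
      exact (hst.inv hd1 ih).1
  have hconst : ∀ s, r ≤ s → Y s d = n - d := by
    intro s hs
    have := h.mono hs d
    have := h.bound s d hd1
    omega
  set Z : ℕ → ℕ → ℕ := fun s x =>
    if s ≤ r then (if x ≤ d then Y s x else Y s (x - 1))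
    else (if x = 0 then 0 else if x ≤ d then Y (s - 1) x + 1 else Y (s - 1) (x - 1)) with hZ
  have hrel : Rel r d Y Z := by
    refine ⟨fun s hs => ⟨fun x hx => ?_, fun x hx => ?_⟩,
      fun s hs => ⟨?_, fun x hx hx' => ?_, fun x hx => ?_⟩⟩
    · simp [hZ, hs, hx]
    · simp [hZ, hs, show ¬ (x + 1 ≤ d) by omega]
    · simp [hZ, show ¬ (s + 1 ≤ r) by omega, h.zero]
    · simp [hZ, show ¬ (s + 1 ≤ r) by omega, show x ≠ 0 by omega, hx']
    · simp [hZ, show ¬ (s + 1 ≤ r) by omega, show ¬ (x + 1 ≤ d) by omega]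
  have hstp : Stp (Z (r + 1)) (Z r) d 0 := by
    obtain ⟨l1, l2⟩ := hrel.1 r le_rfl
    obtain ⟨m0, m1, m2⟩ := hrel.2 r le_rfl
    refine ⟨by omega, ?_, ?_, Or.inl rfl, ?_, ?_⟩
    · rw [m2 d le_rfl, m1 d hd1 le_rfl]; omega
    · intro x a1 a2
      rw [m1 x a1 a2.le, m1 d hd1 le_rfl]
      have := htop x a1 a2; omega
    · intro x a1 a2
      rw [m1 x a1 a2, l1 x a2]
    · intro x hx
      by_cases hxd : x ≤ d
      · obtain rfl : x = 0 := by omega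
        rw [m0, l1 0 (by omega)]
      · obtain ⟨y, rfl⟩ : ∃ y, x = y + 1 := ⟨x - 1, by omega⟩
        rw [l2 y (by omega), m2 y (by omega)]
  refine ⟨d, Z, hd1, hd2, htop, ⟨?_, ?_, ?_, ?_, ?_⟩, hrel, hstp, ?_, ?_⟩
  · intro s
    simp [hZ, h.zero]
  · intro s x hx
    rcases Nat.lt_or_ge r s with hs | hs
    · obtain ⟨s, rfl⟩ : ∃ y, s = y + 1 := ⟨s - 1, by omega⟩
      obtain ⟨m0, m1, m2⟩ := hrel.2 s (by omega)
      rcases lt_trichotomy x d with q | rfl | q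
      · rw [m1 x hx q.le, m1 (x + 1) (by omega) q]
        have := h.anti s x hx; omega
      · rw [m1 x hx le_rfl, m2 x le_rfl]; omega
      · obtain ⟨x, rfl⟩ : ∃ y, x = y + 1 := ⟨x - 1, by omega⟩
        rw [m2 x (by omega), m2 (x + 1) (by omega)]
        exact h.anti s x (by omega)
    · obtain ⟨l1, l2⟩ := hrel.1 s hs
      rcases lt_trichotomy x d with q | rfl | q
      · rw [l1 x q.le, l1 (x + 1) (by omega)]
        exact h.anti s x hx
      · rw [l1 x le_rfl, l2 x le_rfl]
      · obtain ⟨x, rfl⟩ : ∃ y, x = y + 1 := ⟨x - 1, by omega⟩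
        rw [l2 x (by omega), l2 (x + 1) (by omega)]
        exact h.anti s x (by omega)
  · intro x
    simp [hZ, h.init]
  · intro s hs
    rcases lt_trichotomy s r with q | rfl | q
    · obtain ⟨e, b, hst⟩ := h.step s (by omega)
      rcases lo_up hd1 (hrel.1 (s + 1) q) (hrel.1 s q.le) (htops _ q) hst with hh | hh | hh
      · exact ⟨_, _, hh.2⟩
      · exact ⟨_, _, hh.2.2⟩
      · exact ⟨_, _, hh.2⟩
    · exact ⟨_, _, hstp⟩
    · obtain ⟨s, rfl⟩ : ∃ y, s = y + 1 := ⟨s - 1, by omega⟩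
      obtain ⟨e, b, hst⟩ := h.step s (by omega)
      rcases hi_up hd1 (hrel.2 (s + 1) (by omega)) (hrel.2 s (by omega))
        (by rw [hconst _ (by omega), hconst _ (by omega)]) hst with hh | hh
      · exact ⟨_, _, hh.2⟩
      · exact ⟨_, _, hh.2⟩
  · intro s hs x hx
    obtain ⟨s, rfl⟩ : ∃ y, s = y + 1 := ⟨s - 1, by omega⟩
    obtain ⟨m0, m1, m2⟩ := hrel.2 s (by omega)
    by_cases hxd : x ≤ d
    · rw [m1 x hx hxd, h.fin s (by omega) x hx]; omega
    · obtain ⟨x, rfl⟩ : ∃ y, x = y + 1 := ⟨x - 1, by omega⟩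
      rw [m2 x (by omega), h.fin s (by omega) x (by omega)]; omega
  · rw [(hrel.2 r le_rfl).2.1 d hd1 le_rfl]; omega
  · rw [(hrel.1 r le_rfl).2 d le_rfl]; omega

/-- the key step, from large to small -/
theorem exists_down {n l Z} (h : Ch (n + 1) (l + 1) Z) (r : ℕ) (hr : r ≤ l) (d : ℕ)
    (hQ : Q Z (n + 1) r d) :
    ∃ Y, 1 ≤ d ∧ Y r d + d = n ∧ Top d (Y r) ∧ Ch n l Y ∧ Rel r d Y Z := by
  obtain ⟨hst, hq1, hq2⟩ := hQ
  have hd1 : 1 ≤ d := hst.1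
  have hzd : Z r d + 1 = Z (r + 1) d := hst.2.2.2.2.1 d hd1 le_rfl
  have hz1 : ∀ s, r + 1 ≤ s → ∀ x, 1 ≤ x → x ≤ d → 1 ≤ Z s x := by
    intro s hs x hx hxd
    have := h.mono hs x
    have := hst.2.2.2.2.1 x hx hxd
    omega
  have hc1 : ∀ s, r + 1 ≤ s → Z s d + d = n + 1 := by
    intro s hs
    have := h.mono hs d
    have := h.bound s d hd1
    omega
  have hc2 : ∀ s, r ≤ s → Z s (d + 1) + d = n := by
    intro s hs
    have := h.mono hs (d + 1)
    have := h.bound s (d + 1) (by omega)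
    omega
  have htop : Top d (Z r) := (hst.inv hd1 hst.2.2.1).1
  have htops : ∀ s, s ≤ r → Top d (Z s) ∧ Z s (d + 1) = Z s d := by
    intro s hs
    induction hs using Nat.decreasingInduction with
    | self => exact ⟨htop, by omega⟩
    | of_succ k hk ih =>
      obtain ⟨e, b, hst⟩ := h.step k (by omega)
      exact ⟨(hst.inv hd1 ih.1).1, hst.dup hd1 ih.1 ih.2⟩
  set Y : ℕ → ℕ → ℕ := fun s x =>
    if s ≤ r then (if x ≤ d then Z s x else Z s (x + 1))
    else (if x ≤ d then Z (s + 1) x - 1 else Z (s + 1) (x + 1)) with hY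
  have hlo : ∀ s, s ≤ r → Lo d (Y s) (Z s) := by
    intro s hs
    refine ⟨fun x hx => ?_, fun x hx => ?_⟩
    · simp [hY, hs, hx]
    · by_cases hxd : x ≤ d
      · obtain rfl : x = d := by omega
        simp [hY, hs, (htops s hs).2]
      · simp [hY, hs, hxd]
  have hhi : ∀ s, r ≤ s → Hi d (Y s) (Z (s + 1)) := by
    intro s hs
    rcases hs.eq_or_lt with rfl | hs
    · obtain ⟨l1, l2⟩ := hlo r le_rfl
      refine ⟨?_, fun x hx hx' => ?_, fun x hx => ?_⟩
      · rw [← l1 0 (by omega), h.zero, h.zero]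
      · rw [← l1 x hx', hst.2.2.2.2.1 x hx hx']
      · rw [← l2 x hx, hst.2.2.2.2.2 (x + 1) (by omega)]
    · refine ⟨?_, fun x hx hx' => ?_, fun x hx => ?_⟩
      · simp [hY, show ¬ (s ≤ r) by omega, h.zero]
      · have := hz1 (s + 1) (by omega) x hx hx'
        simp [hY, show ¬ (s ≤ r) by omega, hx']; omega
      · by_cases hxd : x ≤ d
        · obtain rfl : x = d := by omega
          have := hc1 (s + 1) (by omega)
          have := hc2 (s + 1) (by omega)
          simp [hY, show ¬ (s ≤ r) by omega]; omega
        · simp [hY, show ¬ (s ≤ r) by omega, hxd]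
  have hyd : ∀ s, r ≤ s → Y s d + d = n := by
    intro s hs
    have := (hhi s hs).2.2 d le_rfl
    have := hc2 (s + 1) (by omega)
    omega
  have htopY : ∀ s, s ≤ r → Top d (Y s) := by
    intro s hs x hx hxd
    rw [← (hlo s hs).1 x hxd.le, ← (hlo s hs).1 d le_rfl]
    exact (htops s hs).1 x hx hxd
  refine ⟨Y, hd1, hyd r le_rfl, htopY r le_rfl, ⟨?_, ?_, ?_, ?_, ?_⟩, hlo, hhi⟩
  · intro s
    simp [hY, h.zero]
  · intro s x hx
    rcases Nat.lt_or_ge s r with hs | hs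
    · obtain ⟨l1, l2⟩ := hlo s hs.le
      rcases Nat.lt_or_ge x d with q | q
      · rw [← l1 x q.le, ← l1 (x + 1) (by omega)]
        exact h.anti s x hx
      · rw [← l2 x q, ← l2 (x + 1) (by omega)]
        exact h.anti s (x + 1) (by omega)
    · obtain ⟨m0, m1, m2⟩ := hhi s hs
      rcases Nat.lt_or_ge x d with q | q
      · have := m1 x hx q.le
        have := m1 (x + 1) (by omega) q
        have := h.anti (s + 1) x hx; omega
      · rw [← m2 x q, ← m2 (x + 1) (by omega)]
        exact h.anti (s + 1) (x + 1) (by omega)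
  · intro x
    simp [hY, h.init]
  · intro s hs
    rcases Nat.lt_or_ge s r with q | q
    · obtain ⟨e, b, hst⟩ := h.step s (by omega)
      rcases lo_down hd1 (hlo (s + 1) q) (hlo s q.le) (htopY _ q) hst with
        hh | ⟨e0, _, _, _, hh⟩ | ⟨e0, b0, _, _, _, hh⟩
      · exact ⟨_, _, hh.2⟩
      · exact ⟨_, _, hh⟩
      · exact ⟨_, _, hh⟩
    · obtain ⟨e, b, hst⟩ := h.step (s + 1) (by omega)
      rcases hi_down hd1 (hhi (s + 1) (by omega)) (hhi s q)
        (by have := hyd (s + 1) (by omega); have := hyd s q; omega) hst with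
        hh | ⟨e0, b0, _, _, _, hh⟩
      · exact ⟨_, _, hh.2⟩
      · exact ⟨_, _, hh⟩
  · intro s hs x hx
    obtain ⟨m0, m1, m2⟩ := hhi s (by omega)
    by_cases hxd : x ≤ d
    · have := m1 x hx hxd
      rw [h.fin (s + 1) (by omega) x hx] at this
      have := hyd r le_rfl
      omega
    · have := m2 x (by omega)
      rw [h.fin (s + 1) (by omega) _ (by omega)] at this
      omega

/-- plus-full-sets with small labels correspond -/
theorem pf_low {n l Y Z r d} (hd1 : 1 ≤ d) (hd2 : Y r d + d = n) (htop : Top d (Y r))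
    (hr : r ≤ l) (hY : Ch n l Y) (hZ : Ch (n + 1) (l + 1) Z) (hrel : Rel r d Y Z) (j : ℕ)
    (hj : j < r) : (∃ k, Q Y n j k) ↔ ∃ k, Q Z (n + 1) j k := by
  have htops : ∀ s, s ≤ r → Top d (Y s) := by
    intro s hs
    induction hs using Nat.decreasingInduction with
    | self => exact htop
    | of_succ k hk ih =>
      obtain ⟨e, b, hst⟩ := hY.step k (by omega)
      exact (hst.inv hd1 ih).1
  constructor
  · rintro ⟨k, hst, h1, h2⟩
    have hk : d ≤ k := by
      by_contra hc
      have := htop k hst.1 (by omega)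
      have := hY.mono (show j + 1 ≤ r from hj) k
      omega
    refine ⟨k + 1, ?_, ?_, ?_⟩
    · rcases lo_up hd1 (hrel.1 (j + 1) hj) (hrel.1 j hj.le) (htops _ hj) hst with hh | hh | hh
      · omega
      · exact hh.2.2
      · omega
    · rw [(hrel.1 (j + 1) hj).2 k hk]; omega
    · rw [(hrel.1 j hj.le).2 (k + 1) (by omega)]; omega
  · rintro ⟨k, hst, h1, h2⟩
    have hk : d + 1 ≤ k := by
      by_contra hc
      have a1 := (hrel.2 r le_rfl).2.1 k hst.1 (by omega)
      have a2 := (hrel.1 r le_rfl).1 k (by omega)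
      have a3 := hZ.mono (show j + 1 ≤ r from hj) k
      have a4 := hZ.bound (r + 1) k hst.1
      omega
    rcases lo_down hd1 (hrel.1 (j + 1) hj) (hrel.1 j hj.le) (htops _ hj) hst with
      hh | ⟨e0, rfl, q, _, hh⟩ | ⟨e0, b0, _, q, _, _⟩
    · omega
    · refine ⟨e0, hh, ?_, ?_⟩
      · rw [(hrel.1 (j + 1) hj).2 e0 q] at h1; omega
      · rw [(hrel.1 j hj.le).2 (e0 + 1) (by omega)] at h2; omega
    · omega

/-- plus-full-sets with large labels correspond -/
theorem pf_high {n l Y Z r d} (hd1 : 1 ≤ d) (hd2 : Y r d + d = n)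
    (hY : Ch n l Y) (hrel : Rel r d Y Z) (j : ℕ)
    (hj : r ≤ j) : (∃ k, Q Y n j k) ↔ ∃ k, Q Z (n + 1) (j + 1) k := by
  have hconst : ∀ s, r ≤ s → Y s d + d = n := by
    intro s hs
    have := hY.mono hs d
    have := hY.bound s d hd1
    omega
  have he : Y j d = Y (j + 1) d := by
    have := hconst j hj
    have := hconst (j + 1) (by omega)
    omega
  constructor
  · rintro ⟨k, hst, h1, h2⟩
    rcases hi_up hd1 (hrel.2 (j + 1) (by omega)) (hrel.2 j hj) he hst with hh | hh
    · refine ⟨k, hh.2, ?_, ?_⟩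
      · rw [(hrel.2 (j + 1) (by omega)).2.1 k hst.1 hh.1.le]; omega
      · rw [(hrel.2 j hj).2.1 (k + 1) (by omega) hh.1]; omega
    · omega
  · rintro ⟨k, hst, h1, h2⟩
    rcases hi_down hd1 (hrel.2 (j + 1) (by omega)) (hrel.2 j hj) he hst with
      hh | ⟨e0, b0, _, q, _, _⟩
    · refine ⟨k, hh.2, ?_, ?_⟩
      · rw [(hrel.2 (j + 1) (by omega)).2.1 k hst.1 hh.1.le] at h1; omega
      · rw [(hrel.2 j hj).2.1 (k + 1) (by omega) hh.1] at h2; omega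
    · omega

theorem Ch.ext {n l Y Y'} (h : Ch n l Y) (h' : Ch n l Y')
    (he : ∀ s, ∀ x, 1 ≤ x → Y s x = Y' s x) : Y = Y' := by
  funext s x
  rcases Nat.eq_zero_or_pos x with rfl | hx
  · rw [h.zero, h'.zero]
  · exact he s x hx

theorem ncard_rel {α β : Type*} (s : Set α) (t : Set β) (R : α → β → Prop)
    (h1 : ∀ a ∈ s, ∃ b ∈ t, R a b) (h2 : ∀ b ∈ t, ∃ a ∈ s, R a b)
    (h3 : ∀ a a' b, a ∈ s → a' ∈ s → R a b → R a' b → a = a')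
    (h4 : ∀ a b b', b ∈ t → b' ∈ t → R a b → R a b' → b = b') : s.ncard = t.ncard := by
  choose f hf hR using h1
  refine Set.ncard_congr f hf ?_ ?_
  · intro a a' ha ha' hab
    refine h3 a a' (f a ha) ha ha' (hR a ha) ?_
    have := hR a' ha'
    rwa [← hab] at this
  · intro b hb
    obtain ⟨a, ha, hab⟩ := h2 b hb
    exact ⟨a, ha, h4 a _ _ (hf a ha) hb (hR a ha) hab⟩

/-- Abstract one-step bijection. -/
theorem step_ncard {n l r : ℕ} (hn : 1 ≤ n) (hr : r ≤ l)
    (A : (ℕ → ℕ → ℕ) → Prop) (B : (ℕ → ℕ → ℕ) → Prop)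
    (hB : ∀ Z, Ch (n + 1) (l + 1) Z → B Z → ∃ d, Q Z (n + 1) r d)
    (hAB : ∀ Y Z, Ch n l Y → Ch (n + 1) (l + 1) Z →
      (∃ d, Q Z (n + 1) r d) →
      (∀ j, j < r → ((∃ k, Q Y n j k) ↔ ∃ k, Q Z (n + 1) j k)) →
      (∀ j, r ≤ j → ((∃ k, Q Y n j k) ↔ ∃ k, Q Z (n + 1) (j + 1) k)) → (A Y ↔ B Z)) :
    Set.ncard {Z | Ch (n + 1) (l + 1) Z ∧ B Z} = Set.ncard {Y | Ch n l Y ∧ A Y} := by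
  symm
  refine ncard_rel _ _ (fun Y Z => ∃ d, 1 ≤ d ∧ Y r d + d = n ∧ Top d (Y r) ∧ Rel r d Y Z ∧
    Q Z (n + 1) r d) ?_ ?_ ?_ ?_
  · rintro Y ⟨hY, hA⟩
    obtain ⟨d, Z, h1, h2, h3, hZ, h4, h5⟩ := exists_up hn hY r hr
    refine ⟨Z, ⟨hZ, ?_⟩, d, h1, h2, h3, h4, h5⟩
    exact (hAB Y Z hY hZ ⟨d, h5⟩ (pf_low h1 h2 h3 hr hY hZ h4) (pf_high h1 h2 hY h4)).1 hA
  · rintro Z ⟨hZ, hBZ⟩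
    obtain ⟨d, h5⟩ := hB Z hZ hBZ
    obtain ⟨Y, h1, h2, h3, hY, h4⟩ := exists_down hZ r hr d h5
    refine ⟨Y, ⟨hY, ?_⟩, d, h1, h2, h3, h4, h5⟩
    exact (hAB Y Z hY hZ ⟨d, h5⟩ (pf_low h1 h2 h3 hr hY hZ h4) (pf_high h1 h2 hY h4)).2 hBZ
  · rintro Y Y' Z ⟨hY, -⟩ ⟨hY', -⟩ ⟨d, h1, h2, h3, h4, h5⟩ ⟨d', h1', h2', h3', h4', h5'⟩
    obtain rfl : d = d' := h5.1.unique h5'.1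
    refine hY.ext hY' fun s x hx => ?_
    rcases Nat.le_total s r with hs | hs
    · rcases Nat.le_total x d with q | q
      · rw [← (h4.1 s hs).1 x q, (h4'.1 s hs).1 x q]
      · rw [← (h4.1 s hs).2 x q, (h4'.1 s hs).2 x q]
    · rcases Nat.le_total x d with q | q
      · have a1 := (h4.2 s hs).2.1 x hx q
        have a2 := (h4'.2 s hs).2.1 x hx q
        omega
      · rw [← (h4.2 s hs).2.2 x q, (h4'.2 s hs).2.2 x q]
  · rintro Y Z Z' ⟨hZ, -⟩ ⟨hZ', -⟩ ⟨d, h1, h2, h3, h4, h5⟩ ⟨d', h1', h2', h3', h4', h5'⟩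
    obtain rfl : d = d' := by
      rcases lt_trichotomy d d' with q | q | q
      · have := h3' d h1 q; omega
      · exact q
      · have := h3 d' h1' q; omega
    refine hZ.ext hZ' fun s x hx => ?_
    rcases Nat.lt_or_ge r s with hs | hs
    · obtain ⟨s, rfl⟩ : ∃ y, s = y + 1 := ⟨s - 1, by omega⟩
      rcases Nat.lt_or_ge d x with q | q
      · obtain ⟨x, rfl⟩ : ∃ y, x = y + 1 := ⟨x - 1, by omega⟩
        rw [(h4.2 s (by omega)).2.2 x (by omega), (h4'.2 s (by omega)).2.2 x (by omega)]
      · rw [(h4.2 s (by omega)).2.1 x hx q, (h4'.2 s (by omega)).2.1 x hx q]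
    · rcases Nat.lt_or_ge d x with q | q
      · obtain ⟨x, rfl⟩ : ∃ y, x = y + 1 := ⟨x - 1, by omega⟩
        rw [(h4.1 s hs).2 x (by omega), (h4'.1 s hs).2 x (by omega)]
      · rw [(h4.1 s hs).1 x q, (h4'.1 s hs).1 x q]

theorem pf_succ {Y : ℕ → ℕ → ℕ} {n j : ℕ} : PF Y n (j + 1) ↔ ∃ k, Q Y n j k := by
  constructor
  · rintro ⟨r, k, h, hq⟩
    obtain rfl : j = r := by omega
    exact ⟨k, hq⟩
  · rintro ⟨k, hq⟩; exact ⟨j, k, rfl, hq⟩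

theorem pf_zero {Y : ℕ → ℕ → ℕ} {n : ℕ} : ¬ PF Y n 0 := by
  rintro ⟨r, k, h, -⟩; omega

/-- Chain version of the theorem. -/
theorem chain_main (m q : ℕ) (hm : 1 ≤ m) (t : ℕ) : ∀ (U : Finset ℕ), U.card = t →
    (∀ u ∈ U, 1 ≤ u ∧ u ≤ q + t) →
    Set.ncard {Y | Ch (m + t) (q + t) Y ∧ ∀ j, PF Y (m + t) j ↔ j ∈ U} =
      Set.ncard {Y | Ch m q Y ∧ ∀ j, ¬ PF Y m j} ∧
    Set.ncard {Y | Ch (m + t) (q + t) Y ∧ ∀ j ∈ U, PF Y (m + t) j} =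
      Set.ncard {Y | Ch m q Y} := by
  induction t with
  | zero =>
    intro U hU _
    obtain rfl := Finset.card_eq_zero.1 hU
    simp
  | succ t ih =>
    intro U hU hb
    have hne : U.Nonempty := by
      rw [← Finset.card_pos]; omega
    obtain ⟨u, hmem, hmax⟩ : ∃ u ∈ U, ∀ x ∈ U, x ≤ u :=
      ⟨U.max' hne, U.max'_mem hne, fun x hx => U.le_max' x hx⟩
    obtain ⟨r, rfl⟩ : ∃ r, u = r + 1 := ⟨u - 1, by have := (hb u hmem).1; omega⟩
    have hr : r ≤ q + t := by have := (hb _ hmem).2; omega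
    have hU' : (U.erase (r + 1)).card = t := by
      rw [Finset.card_erase_of_mem hmem, hU]; rfl
    obtain ⟨ih1, ih2⟩ := ih (U.erase (r + 1)) hU' (by
      intro v hv
      rw [Finset.mem_erase] at hv
      have h1 := hb v hv.2
      have h2 := hmax v hv.2
      have h3 := (hb _ hmem).2
      have := hv.1
      omega)
    constructor
    · rw [← ih1]
      refine step_ncard (r := r) (n := m + t) (l := q + t) (by omega) hr _ _ ?_ ?_
      · intro Z hZ hB
        exact pf_succ.1 ((hB (r + 1)).2 hmem)
      · intro Y Z hY hZ hQ hlow hhigh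
        simp only [← pf_succ] at hQ hlow hhigh
        constructor
        · intro hA j
          rcases j with _ | j
          · refine ⟨fun hc => absurd hc pf_zero, fun hc => ?_⟩
            have := (hb _ hc).1; omega
          · rcases lt_trichotomy j r with hj | rfl | hj
            · rw [← add_assoc, ← hlow j hj, hA (j + 1), Finset.mem_erase]
              exact ⟨fun h => h.2, fun h => ⟨by omega, h⟩⟩
            · exact ⟨fun _ => hmem, fun _ => hQ⟩
            · obtain ⟨j, rfl⟩ : ∃ y, j = y + 1 := ⟨j - 1, by omega⟩
              rw [← add_assoc, ← hhigh j (by omega), hA (j + 1), Finset.mem_erase]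
              constructor
              · intro h
                have := hmax _ h.2
                have := h.1
                omega
              · intro h
                have := hmax _ h
                omega
        · intro hB j
          rcases j with _ | j
          · refine ⟨fun hc => absurd hc pf_zero, fun hc => ?_⟩
            have := (hb _ (Finset.mem_erase.1 hc).2).1; omega
          · rcases Nat.lt_or_ge j r with hj | hj
            · rw [hlow j hj, Finset.mem_erase]
              refine (hB (j + 1)).trans ⟨fun h => ⟨by omega, h⟩, fun h => h.2⟩
            · rw [hhigh j hj, Finset.mem_erase]
              refine (hB (j + 1 + 1)).trans ⟨fun h => ?_, fun h => ?_⟩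
              · have := hmax _ h; omega
              · have := hmax _ h.2
                have := h.1
                omega
    · rw [← ih2]
      refine step_ncard (r := r) (n := m + t) (l := q + t) (by omega) hr _ _ ?_ ?_
      · intro Z hZ hB
        exact pf_succ.1 (hB (r + 1) hmem)
      · intro Y Z hY hZ hQ hlow hhigh
        simp only [← pf_succ] at hQ hlow hhigh
        constructor
        · intro hA j hjU
          rcases j with _ | j
          · have := (hb _ hjU).1; omega
          · have := hmax _ hjU
            rcases lt_trichotomy j r with hj | rfl | hj
            · exact (hlow j hj).1 (hA (j + 1) (Finset.mem_erase.2 ⟨by omega, hjU⟩))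
            · exact hQ
            · omega
        · intro hB j hjU
          rw [Finset.mem_erase] at hjU
          rcases j with _ | j
          · have := (hb _ hjU.2).1; omega
          · have := hmax _ hjU.2
            have := hjU.1
            exact (hlow j (by omega)).2 (hB (j + 1) hjU.2)

/-! ### Translation between tableaux and chains -/

theorem anti_le {lam : ℕ → ℕ} (h : ∀ x, 1 ≤ x → lam (x + 1) ≤ lam x) {x y : ℕ} (hx : 1 ≤ x)
    (hxy : x ≤ y) : lam y ≤ lam x := by
  induction y, hxy using Nat.le_induction with
  | base => exact le_rfl
  | succ y hy ih => exact (h y (by omega)).trans ih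

theorem cover_iff {lam mu : ℕ → ℕ} (h : ∀ x, 1 ≤ x → lam (x + 1) ≤ lam x) :
    TamariCoverY mu lam ↔ ∃ e b, Stp lam mu e b := by
  constructor
  · rintro ⟨d, ⟨hd, hd1, hc⟩, rfl⟩
    have hmem : primeHeight lam d ∈ {t | 1 ≤ t ∧ (t = d ∨ (t < d ∧ lam d + t ≤ lam (d - t)))} :=
      Nat.sInf_mem ⟨d, hd, Or.inl rfl⟩
    have hmin : ∀ t, t < primeHeight lam d →
        t ∉ {t | 1 ≤ t ∧ (t = d ∨ (t < d ∧ lam d + t ≤ lam (d - t)))} :=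
      fun t ht => Nat.notMem_of_lt_sInf ht
    unfold removeStrip
    generalize primeHeight lam d = p at hmem hmin
    obtain ⟨hp1, hp⟩ := hmem
    have hpd : p ≤ d := by omega
    refine ⟨d, d - p, by omega, hc, ?_, ?_, ?_, ?_⟩
    · intro x a1 a2
      have := hmin (d - x) (by omega)
      simp only [Set.mem_setOf_eq] at this
      rw [show d - (d - x) = x by omega] at this
      by_contra hcon
      exact this ⟨by omega, Or.inr ⟨by omega, by omega⟩⟩
    · rcases hp with rfl | hp
      · left; omega
      · right; omega
    · intro x a1 a2
      have := anti_le h (x := x) (y := d) (by omega) a2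
      simp only []
      rw [if_pos (by omega)]; omega
    · intro x hx
      simp only []
      rw [if_neg (by omega)]
  · rintro ⟨e, b, h1, h2, h3, h4, h5, h6⟩
    have hp : primeHeight lam e = e - b := by
      refine IsLeast.csInf_eq ⟨⟨by omega, ?_⟩, ?_⟩
      · rcases Nat.eq_zero_or_pos b with q | q
        · left; omega
        · right
          rw [show e - (e - b) = b by omega]
          omega
      · rintro t ⟨ht1, ht⟩
        by_contra hcon
        have := h3 (e - t) (by omega) (by omega)
        omega
    refine ⟨e, ⟨by omega, by omega, h2⟩, ?_⟩
    funext x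
    unfold removeStrip
    rw [hp]
    by_cases hx : b < x ∧ x ≤ e
    · rw [if_pos (by omega)]
      have := h5 x hx.1 hx.2; omega
    · rw [if_neg (by omega)]
      exact h6 x hx

theorem tc_step {Y l} (h : IsTamariChain Y l) (s : ℕ) (hs : s < l) :
    ∃ e b, Stp (Y (s + 1)) (Y s) e b :=
  (cover_iff (h.1 (s + 1) hs).2.1).1 (h.2.2 s hs)

theorem tc_mono {Y l} (h : IsTamariChain Y l) {s s' : ℕ} (hs : s ≤ s') (hs' : s' ≤ l) (x : ℕ) :
    Y s x ≤ Y s' x := by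
  induction s', hs using Nat.le_induction with
  | base => exact le_rfl
  | succ k hk ih =>
    obtain ⟨e, b, hst⟩ := tc_step h k hs'
    exact (ih (by omega)).trans (hst.le x)

theorem psi_le {Y l} (h : IsTamariChain Y l) {s : ℕ} (hs : s ≤ l) (x y : ℕ) :
    (psiFun Y l (x, y) ≠ 0 ∧ psiFun Y l (x, y) ≤ s) ↔ 1 ≤ x ∧ 1 ≤ y ∧ y ≤ Y s x := by
  unfold psiFun
  simp only []
  by_cases hb : 1 ≤ x ∧ 1 ≤ y ∧ y ≤ Y l x
  · rw [if_pos hb]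
    have hmem : sInf {r | r ≤ l ∧ y ≤ Y r x} ∈ {r | r ≤ l ∧ y ≤ Y r x} :=
      Nat.sInf_mem ⟨l, le_rfl, hb.2.2⟩
    constructor
    · rintro ⟨_, h2⟩
      exact ⟨hb.1, hb.2.1, hmem.2.trans (tc_mono h h2 hs x)⟩
    · rintro ⟨_, _, h3⟩
      refine ⟨?_, Nat.sInf_le ⟨hs, h3⟩⟩
      intro h0
      rw [h0] at hmem
      have := hmem.2
      rw [h.2.1] at this
      omega
  · rw [if_neg hb]
    constructor
    · rintro ⟨h1, _⟩; exact absurd rfl h1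
    · rintro ⟨h1, h2, h3⟩
      exact absurd ⟨h1, h2, h3.trans (tc_mono h hs le_rfl x)⟩ hb

theorem psi_le_l {Y l} (h : IsTamariChain Y l) (x y : ℕ) : psiFun Y l (x, y) ≤ l := by
  unfold psiFun
  simp only []
  split_ifs with hb
  · exact Nat.sInf_le ⟨le_rfl, hb.2.2⟩
  · omega

theorem psi_ne {Y l} (h : IsTamariChain Y l) (x y : ℕ) :
    psiFun Y l (x, y) ≠ 0 ↔ 1 ≤ x ∧ 1 ≤ y ∧ y ≤ Y l x := by
  rw [← psi_le h le_rfl]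
  exact ⟨fun q => ⟨q, psi_le_l h x y⟩, fun q => q.1⟩

theorem psi_eq {Y l} (h : IsTamariChain Y l) {r : ℕ} (hr : r < l) (x y : ℕ) :
    psiFun Y l (x, y) = r + 1 ↔ 1 ≤ x ∧ 1 ≤ y ∧ Y r x < y ∧ y ≤ Y (r + 1) x := by
  have h1 := psi_le h (show r ≤ l by omega) x y
  have h2 := psi_le h (show r + 1 ≤ l by omega) x y
  constructor
  · intro h3
    have a := h2.1 ⟨by omega, by omega⟩
    refine ⟨a.1, a.2.1, ?_, a.2.2⟩
    by_contra hc
    have := h1.2 ⟨a.1, a.2.1, by omega⟩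
    omega
  · rintro ⟨a1, a2, a3, a4⟩
    have b := h2.2 ⟨a1, a2, a4⟩
    by_contra hc
    have := h1.1 ⟨b.1, by omega⟩
    omega

theorem psi_rowLen {Y l} (h : IsTamariChain Y l) (x : ℕ) : rowLen (psiFun Y l) x = Y l x := by
  unfold rowLen
  simp only [psi_ne h]
  have h0 := (h.1 l le_rfl).1
  by_cases hx : 1 ≤ x ∧ 1 ≤ Y l x
  · refine IsGreatest.csSup_eq ⟨⟨hx.1, hx.2, le_rfl⟩, ?_⟩
    rintro y ⟨_, _, hy⟩; exact hy
  · have he : {y | 1 ≤ x ∧ 1 ≤ y ∧ y ≤ Y l x} = ∅ := by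
      ext y
      simp only [Set.mem_setOf_eq, Set.mem_empty_iff_false, iff_false]
      omega
    rw [he]
    simp only [csSup_empty, Nat.bot_eq_zero]
    rcases Nat.eq_zero_or_pos x with rfl | q
    · exact h0.symm
    · omega

theorem psi_exists {Y l} (h : IsTamariChain Y l) {r : ℕ} (hr : r < l) :
    ∃ b, psiFun Y l b = r + 1 := by
  obtain ⟨e, b, hst⟩ := tc_step h r hr
  have h5 := hst.2.2.2.2.1 e hst.1 le_rfl
  have := hst.1
  exact ⟨(e, Y (r + 1) e), (psi_eq h hr _ _).2 ⟨by omega, by omega, by omega, le_rfl⟩⟩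

theorem psi_tlen {Y l} (h : IsTamariChain Y l) : tlen (psiFun Y l) = l := by
  unfold tlen
  rcases Nat.eq_zero_or_pos l with rfl | hl
  · have he : {v | v ≠ 0 ∧ ∃ b, psiFun Y 0 b = v} = ∅ := by
      ext v
      simp only [Set.mem_setOf_eq, Set.mem_empty_iff_false, iff_false]
      rintro ⟨hv, ⟨x, y⟩, rfl⟩
      have := psi_le_l h x y
      omega
    rw [he]; simp
  · refine IsGreatest.csSup_eq ⟨⟨by omega, ?_⟩, ?_⟩
    · obtain ⟨b, hb⟩ := psi_exists h (show l - 1 < l by omega)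
      exact ⟨b, by omega⟩
    · rintro v ⟨_, ⟨x, y⟩, rfl⟩
      exact psi_le_l h x y

theorem psi_tab {Y l} (h : IsTamariChain Y l) : IsTableau (psiFun Y l) := by
  have hD := h.1 l le_rfl
  refine ⟨?_, ?_, ?_, ?_, ?_, ?_, ?_⟩
  · intro y; by_contra hc
    have := (psi_ne h 0 y).1 hc; omega
  · intro x; by_contra hc
    have := (psi_ne h x 0).1 hc; omega
  · obtain ⟨N, hN⟩ := hD.2.2
    refine ((Set.finite_Iic N).prod (Set.finite_Iic (Y l 1))).subset ?_
    rintro ⟨x, y⟩ hb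
    have hb := (psi_ne h x y).1 hb
    refine ⟨?_, hb.2.2.trans (anti_le hD.2.1 le_rfl hb.1)⟩
    by_contra hc
    have := hN x (by simp only [Set.mem_Iic] at hc; omega)
    omega
  · intro x y x' y' hx hx' hy hy' hne
    rw [psi_ne h] at hne ⊢
    have := anti_le hD.2.1 hx hx'
    exact ⟨hx, hy, by omega⟩
  · intro x y h1 h2
    have h3 := psi_le_l h x (y + 1)
    have h4 := (psi_le h h3 x (y + 1)).1 ⟨h2, le_rfl⟩
    have h6 := (psi_ne h x y).1 h1
    obtain ⟨r, hr⟩ : ∃ r, psiFun Y l (x, y + 1) = r + 1 := ⟨_, (Nat.succ_pred h2).symm⟩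
    have h5 := (psi_eq h (show r < l by omega) x (y + 1)).1 hr
    obtain ⟨e, b, hst⟩ := tc_step h r (by omega)
    have h7 : Y (r + 1) x ≤ Y r x + 1 := by
      by_cases hm : b < x ∧ x ≤ e
      · have := hst.2.2.2.2.1 x hm.1 hm.2; omega
      · have := hst.2.2.2.2.2 x hm; omega
    have := (psi_le h (show r ≤ l by omega) x y).2 ⟨h6.1, h6.2.1, by omega⟩
    omega
  · intro x y h1 h2
    have h3 := psi_le_l h (x + 1) y
    have h4 := (psi_le h h3 (x + 1) y).1 ⟨h2, le_rfl⟩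
    have h6 := (psi_ne h x y).1 h1
    have := (h.1 _ h3).2.1 x h6.1
    exact ((psi_le h h3 x y).2 ⟨h6.1, h6.2.1, by omega⟩).2
  · intro v hv
    rw [psi_tlen h]
    constructor
    · intro hvl
      obtain ⟨b, hb⟩ := psi_exists h (show v - 1 < l by omega)
      exact ⟨b, by omega⟩
    · rintro ⟨⟨x, y⟩, rfl⟩
      exact psi_le_l h x y

theorem Ch.tc {n l Y} (h : Ch n l Y) : IsTamariChain Y l := by
  refine ⟨fun r _ => ⟨h.zero r, h.anti r, n + 1, fun x hx => ?_⟩, h.init, fun r hr => ?_⟩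
  · have := h.bound r x (by omega); omega
  · exact (cover_iff (h.anti (r + 1))).2 (h.step r hr)

theorem Ch.last {n l Y} (h : Ch n l Y) (x : ℕ) : Y l x = dstair n x := by
  unfold dstair
  split_ifs with hx
  · rw [hx, h.zero]
  · exact h.fin l le_rfl x (by omega)

theorem tc_ch {n l Y} (h : IsTamariChain Y l) (hl : ∀ x, Y l x = dstair n x) :
    Ch n l (fun s => Y (min s l)) ∧ psiFun (fun s => Y (min s l)) l = psiFun Y l := by
  constructor
  · refine ⟨?_, ?_, ?_, ?_, ?_⟩
    · intro s; exact (h.1 _ (min_le_right s l)).1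
    · intro s; exact (h.1 _ (min_le_right s l)).2.1
    · intro x
      simp only [Nat.zero_min]; exact h.2.1 x
    · intro s hs
      simp only [min_eq_left hs.le, min_eq_left (show s + 1 ≤ l from hs)]
      exact tc_step h s hs
    · intro s hs x hx
      simp only [min_eq_right hs]
      rw [hl]; unfold dstair; rw [if_neg (by omega)]
  · funext b
    unfold psiFun
    simp only [min_self]
    congr 2
    ext r
    simp only [Set.mem_setOf_eq]
    constructor
    · rintro ⟨h1, h2⟩
      rw [min_eq_left h1] at h2; exact ⟨h1, h2⟩
    · rintro ⟨h1, h2⟩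
      rw [min_eq_left h1]; exact ⟨h1, h2⟩

theorem psi_inj {n l Y Y'} (h : Ch n l Y) (h' : Ch n l Y') (he : psiFun Y l = psiFun Y' l) :
    Y = Y' := by
  refine h.ext h' fun s x hx => ?_
  rcases Nat.le_total s l with hs | hs
  · have key : ∀ y, 1 ≤ y → (y ≤ Y s x ↔ y ≤ Y' s x) := by
      intro y hy
      have a := psi_le h.tc hs x y
      have b := psi_le h'.tc hs x y
      rw [he] at a
      have c := a.symm.trans b
      constructor
      · intro q; exact (c.1 ⟨hx, hy, q⟩).2.2
      · intro q; exact (c.2 ⟨hx, hy, q⟩).2.2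
    have k1 := key (Y s x)
    have k2 := key (Y' s x)
    omega
  · rw [h.fin s hs x hx, h'.fin s hs x hx]

theorem memC_iff {i : ℤ} {n l : ℕ} (hl : (l : ℤ) = n + i) (f : ℕ × ℕ → ℕ) :
    MemC i n f ↔ ∃ Y, Ch n l Y ∧ psiFun Y l = f := by
  constructor
  · rintro ⟨_, ⟨l', Y, hY, rfl⟩, h3, h4⟩
    rw [psi_tlen hY] at h4
    obtain rfl : l' = l := by omega
    simp only [psi_rowLen hY] at h3
    exact ⟨_, tc_ch hY h3⟩
  · rintro ⟨Y, hY, rfl⟩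
    refine ⟨psi_tab hY.tc, ⟨l, Y, hY.tc, rfl⟩, fun x => ?_, ?_⟩
    · rw [psi_rowLen hY.tc, hY.last]
    · rw [psi_tlen hY.tc, hl]

theorem plus_iff {n l Y} (h : Ch n l Y) (j : ℕ) :
    HasPlusFullSet (psiFun Y l) n j ↔ PF Y n j := by
  have ht := h.tc
  rcases j with _ | r
  · refine ⟨?_, fun hc => absurd hc pf_zero⟩
    rintro ⟨k, ⟨_, h1, h2, h3, _⟩, _⟩
    have hk := (psi_ne ht k (n - k)).2 ⟨h1, by omega, by rw [h.fin l le_rfl k h1]⟩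
    exact absurd h3 hk
  rw [pf_succ]
  by_cases hr : r < l
  swap
  · constructor
    · rintro ⟨k, ⟨⟨y, hy⟩, _⟩, _⟩
      have := psi_le_l ht 1 y; omega
    · rintro ⟨k, hst, _⟩
      have hne := hst.ne (x := k) hst.1 le_rfl
      rw [h.fin r (by omega) k hst.1, h.fin (r + 1) (by omega) k hst.1] at hne
      exact absurd rfl hne
  have hlow : ∀ x y, 1 ≤ x → 1 ≤ y → y ≤ n - x → (psiFun Y l (x, y) < r + 1 ↔ y ≤ Y r x) := by
    intro x y hx hy hyn
    have a := psi_le ht hr.le x y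
    have b := (psi_ne ht x y).2 ⟨hx, hy, by rw [h.fin l le_rfl x hx]; exact hyn⟩
    constructor
    · intro q; exact (a.1 ⟨b, by omega⟩).2.2
    · intro q
      have := (a.2 ⟨hx, hy, q⟩).2; omega
  constructor
  · rintro ⟨k, ⟨⟨y, hy⟩, h1, h2, h3, h4⟩, h5⟩
    rw [psi_eq ht hr] at hy h3
    obtain ⟨e, b, hst⟩ := tc_step ht r hr
    have hm1 := hst.mem (x := 1) (by omega)
    have hmk := hst.mem (x := k) (by omega)
    have he : e ≤ k := by
      have := hst.2.2.2.2.1 e hst.1 le_rfl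
      exact h4 e (Y (r + 1) e) ((psi_eq ht hr _ _).2 ⟨by omega, by omega, by omega, le_rfl⟩)
    obtain rfl : e = k := by omega
    obtain rfl : b = 0 := by omega
    refine ⟨e, hst, ?_, ?_⟩
    · have := h.bound (r + 1) e h1; omega
    · have hb := h.bound r (e + 1) (by omega)
      rcases h5 with h5 | ⟨h5, h6⟩
      · omega
      · rw [hlow (e + 1) _ (by omega) (by omega) (by omega)] at h6
        omega
  · rintro ⟨k, hst, h1, h2⟩
    have hk := hst.1
    have a1 := hst.2.2.2.2.1 1 (by omega) (by omega)
    have ak := hst.2.2.2.2.1 k hk le_rfl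
    refine ⟨k, ⟨⟨Y (r + 1) 1, ?_⟩, hk, by omega, ?_, ?_⟩, ?_⟩
    · exact (psi_eq ht hr _ _).2 ⟨le_rfl, by omega, by omega, le_rfl⟩
    · exact (psi_eq ht hr _ _).2 ⟨hk, by omega, by omega, by omega⟩
    · intro x y hxy
      rw [psi_eq ht hr] at hxy
      exact (hst.mem (x := x) (by omega)).2
    · by_cases hkn : k = n - 1
      · exact Or.inl hkn
      · right
        refine ⟨by omega, ?_⟩
        rw [hlow (k + 1) _ (by omega) (by omega) (by omega)]
        omega

theorem ncard_transfer {i : ℤ} {n l : ℕ} (hl : (l : ℤ) = n + i) (G : (ℕ × ℕ → ℕ) → Prop)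
    (G' : (ℕ → ℕ → ℕ) → Prop) (hG : ∀ Y, Ch n l Y → (G (psiFun Y l) ↔ G' Y)) :
    Set.ncard {C | MemC i n C ∧ G C} = Set.ncard {Y | Ch n l Y ∧ G' Y} := by
  have he : {C | MemC i n C ∧ G C} = (fun Y => psiFun Y l) '' {Y | Ch n l Y ∧ G' Y} := by
    ext C
    simp only [Set.mem_setOf_eq, Set.mem_image, memC_iff hl]
    constructor
    · rintro ⟨⟨Y, hY, rfl⟩, hg⟩
      exact ⟨Y, ⟨hY, (hG Y hY).1 hg⟩, rfl⟩
    · rintro ⟨Y, ⟨hY, hg⟩, rfl⟩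
      exact ⟨⟨Y, hY, rfl⟩, (hG Y hY).2 hg⟩
  rw [he]
  refine Set.ncard_image_of_injOn ?_
  rintro Y ⟨hY, -⟩ Y' ⟨hY', -⟩ h
  exact psi_inj hY hY' h

/-- **Corollary 5.6 (equal representation).**  Let `i ≥ -1`, `n ≥ 1`, `0 ≤ t ≤ n - 1` and let
`U` be a `t`-element subset of `[n+i]`.  Then the number of `C ∈ C_i(n)` with
`{j : C has a j⁺-full-set} = U` equals `#N_i(n-t)`, and the number of `C ∈ C_i(n)` with
`U ⊆ {j : C has a j⁺-full-set}` equals `#C_i(n-t)`. -/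
theorem equal_representation (i : ℤ) (hi : -1 ≤ i) (n : ℕ) (hn : 1 ≤ n) (t : ℕ)
    (ht : t ≤ n - 1) (U : Finset ℕ) (hcard : U.card = t)
    (hU : ∀ u ∈ U, 1 ≤ u ∧ (u : ℤ) ≤ (n : ℤ) + i) :
    Set.ncard {C : ℕ × ℕ → ℕ | MemC i n C ∧ ∀ j, HasPlusFullSet C n j ↔ j ∈ U} =
      Set.ncard {C : ℕ × ℕ → ℕ | MemN i (n - t) C} ∧
    Set.ncard {C : ℕ × ℕ → ℕ | MemC i n C ∧ ∀ j ∈ U, HasPlusFullSet C n j} =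
      Set.ncard {C : ℕ × ℕ → ℕ | MemC i (n - t) C} := by
  obtain ⟨m, rfl⟩ : ∃ m, n = m + t := ⟨n - t, by omega⟩
  obtain ⟨q, hq⟩ : ∃ q : ℕ, (q : ℤ) = (m : ℤ) + i := ⟨((m : ℤ) + i).toNat, by omega⟩
  have hq' : ((q + t : ℕ) : ℤ) = ((m + t : ℕ) : ℤ) + i := by push_cast; omega
  obtain ⟨h1, h2⟩ := chain_main m q (by omega) t U hcard (by
    intro u hu
    have := hU u hu
    push_cast at this
    omega)
  rw [Nat.add_sub_cancel]
  constructor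
  · rw [ncard_transfer hq' _ (fun Y => ∀ j, PF Y (m + t) j ↔ j ∈ U)
      (fun Y hY => by simp only [plus_iff hY]), h1]
    unfold MemN
    rw [ncard_transfer hq _ (fun Y => ∀ j, ¬ PF Y m j) (fun Y hY => by simp only [plus_iff hY])]
  · rw [ncard_transfer hq' _ (fun Y => ∀ j ∈ U, PF Y (m + t) j)
      (fun Y hY => by simp only [plus_iff hY]), h2]
    have := ncard_transfer hq (fun _ => True) (fun _ => True) (fun Y hY => Iff.rfl)
    simpa using this.symm

end TamariMaxChains
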